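/- The factorial Schur function s_μ(x|y) equals the Schur function s_μ(x) plus terms of lower degree in the x variables; in particular, s_μ(x|y) is symmetric in x_1,...,x_d. -/

import Mathlib

open scoped Classical
open MvPolynomial

noncomputable section

namespace EqLR

/-- Ambient polynomial ring `ℂ[x_1,…,x_d ; y_i (i ∈ ℤ)]`.
The variables `x_j` are indexed by `Fin d` (so `x_{j+1} = X (Sum.inl j)`), and the
variables `y_i` are indexed by `ℤ` (only positive indices actually occur). -/
abbrev P (d : ℕ) := MvPolynomial (Fin d ⊕ ℤ) ℂ

/-- The variable `y_i`. -/
def yI (d : ℕ) (i : ℤ) : P d := X (Sum.inr i)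

/-- The variable `x_v` for a value `v ∈ {1,…,d}` (junk value `0` otherwise). -/
def xv (d : ℕ) (v : ℕ) : P d :=
  if h : v - 1 < d then X (Sum.inl ⟨v - 1, h⟩) else 0

/-- The component `ξ_v` of a vector `ξ ∈ ℕ^d`, for a (1-based) value `v ∈ {1,…,d}`. -/
def vecAt {d : ℕ} (ξ : Fin d → ℕ) (v : ℕ) : ℕ :=
  if h : v - 1 < d then ξ ⟨v - 1, h⟩ else 0

/-- `μ ∈ ℕ^d` is a partition:  `μ_1 ≥ μ_2 ≥ … ≥ μ_d`. -/
def IsPartitionVec {d : ℕ} (μ : Fin d → ℕ) : Prop :=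
  ∀ i j : Fin d, i ≤ j → μ j ≤ μ i

/-- `|μ| = μ_1 + ⋯ + μ_d`. -/
def wt {d : ℕ} (μ : Fin d → ℕ) : ℕ := ∑ i, μ i

/-- `ρ = (d-1, d-2, …, 0)`. -/
def rho (d : ℕ) : Fin d → ℕ := fun i => d - 1 - (i : ℕ)

/-- Cells `(r, c)` (both 0-based) of the Young/reverse Young diagram whose row `r` has
length `μ_{r+1}`.  For the reverse diagram, rows are numbered bottom-to-top and columns
right-to-left; for the ordinary Young diagram, top-to-bottom and left-to-right. -/
def cells (d : ℕ) (μ : Fin d → ℕ) : Finset (ℕ × ℕ) :=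
  (Finset.range d ×ˢ Finset.range (Finset.univ.sup μ + 1)).filter
    fun rc => ∃ h : rc.1 < d, rc.2 < μ ⟨rc.1, h⟩

/-- In the column reading word of a *reverse* diagram (columns right-to-left, i.e. in
increasing 0-based column index, each column read top-to-bottom, i.e. in decreasing
0-based row index), the cell `b` is read strictly before the cell `a`. -/
def revBefore (a b : ℕ × ℕ) : Prop := b.2 < a.2 ∨ (b.2 = a.2 ∧ a.1 < b.1)

/-- In the column reading word of an ordinary Young diagram (rightmost column first,
each column read top-to-bottom), the cell `b` is read strictly before the cell `a`. -/
def youngBefore (a b : ℕ × ℕ) : Prop := a.2 < b.2 ∨ (b.2 = a.2 ∧ b.1 < a.1)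

/-- A reverse tableau of shape `μ`: entries in `{1,…,d}`, weakly increasing along rows
(left to right) and strictly increasing down columns (top to bottom). -/
structure RevTableau (d : ℕ) (μ : Fin d → ℕ) where
  val : ℕ × ℕ → ℕ
  mem : ∀ a ∈ cells d μ, 1 ≤ val a ∧ val a ≤ d
  zero : ∀ a ∉ cells d μ, val a = 0
  row : ∀ r c : ℕ, (r, c + 1) ∈ cells d μ → val (r, c + 1) ≤ val (r, c)
  col : ∀ r c : ℕ, (r + 1, c) ∈ cells d μ → val (r + 1, c) < val (r, c)

/-- The factor `x_v - y_{(d+1-v) + c(a) - r(a)}` attached to an entry of value `v` in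
the cell `a` of the reverse diagram (`c(a) = a.2 + 1`, `r(a) = a.1 + 1`, 1-based). -/
def factor (d : ℕ) (v : ℕ) (a : ℕ × ℕ) : P d :=
  xv d v - yI d ((d : ℤ) + 1 - (v : ℤ) + (a.2 : ℤ) - (a.1 : ℤ))

/-- The factorial Schur function `s_μ(x|y) = Σ_R (x|y)^R`. -/
def fSchur (d : ℕ) (μ : Fin d → ℕ) : P d :=
  ∑ᶠ R : RevTableau d μ, ∏ a ∈ cells d μ, factor d (R.val a) a

/-- The ordinary Schur function `s_μ(x) = Σ_R x^R`. -/
def schurX (d : ℕ) (μ : Fin d → ℕ) : P d :=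
  ∑ᶠ R : RevTableau d μ, ∏ a ∈ cells d μ, xv d (R.val a)

/-- The subalgebra `ℂ[y]` of polynomials in the `y` variables only. -/
def ySub (d : ℕ) : Subalgebra ℂ (P d) :=
  Algebra.adjoin ℂ (Set.range fun i : ℤ => yI d i)

/-- `p` is symmetric in the `x` variables. -/
def SymmX {d : ℕ} (p : P d) : Prop :=
  ∀ σ : Equiv.Perm (Fin d), rename (⇑(Equiv.sumCongr σ (Equiv.refl ℤ))) p = p

/-- The falling factorial power `(x_j | y)^k = (x_j - y_1)⋯(x_j - y_k)`. -/
def ffPow (d : ℕ) (j : Fin d) (k : ℕ) : P d :=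
  ∏ i ∈ Finset.range k, (X (Sum.inl j) - yI d ((i : ℤ) + 1))

/-- `(x|y)^ξ = (x_1|y)^{ξ_1} ⋯ (x_d|y)^{ξ_d}`. -/
def xyPow (d : ℕ) (ξ : Fin d → ℕ) : P d := ∏ j : Fin d, ffPow d j (ξ j)

/-- The alternant `a_ξ(x|y) = det[(x_j|y)^{ξ_i}]`. -/
def aDet (d : ℕ) (ξ : Fin d → ℕ) : P d :=
  Matrix.det (Matrix.of fun i j : Fin d => ffPow d j (ξ i))

/-! ### Skew barred tableaux of shape `λ*μ` -/

/-- A skew barred tableau of shape `λ*μ`: the Young diagram `λ` (placed above and to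
the right of the reverse diagram `μ`) is filled with values in `{1,…,d}` (field `top`),
the reverse diagram `μ` is filled with values in `{1,…,d}` (field `bot`), some of whose
cells may be barred (field `barred`); values weakly increase along rows left-to-right
and strictly increase down columns, ignoring bars. -/
structure SkewBarredTableau (d : ℕ) (lam mu : Fin d → ℕ) where
  top : ℕ × ℕ → ℕ
  bot : ℕ × ℕ → ℕ
  barred : ℕ × ℕ → Prop
  top_mem : ∀ a ∈ cells d lam, 1 ≤ top a ∧ top a ≤ d
  top_zero : ∀ a ∉ cells d lam, top a = 0
  bot_mem : ∀ a ∈ cells d mu, 1 ≤ bot a ∧ bot a ≤ d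
  bot_zero : ∀ a ∉ cells d mu, bot a = 0
  barred_sub : ∀ a, barred a → a ∈ cells d mu
  top_row : ∀ r c : ℕ, (r, c + 1) ∈ cells d lam → top (r, c) ≤ top (r, c + 1)
  top_col : ∀ r c : ℕ, (r + 1, c) ∈ cells d lam → top (r, c) < top (r + 1, c)
  bot_row : ∀ r c : ℕ, (r, c + 1) ∈ cells d mu → bot (r, c + 1) ≤ bot (r, c)
  bot_col : ∀ r c : ℕ, (r + 1, c) ∈ cells d mu → bot (r + 1, c) < bot (r, c)

namespace SkewBarredTableau

variable {d : ℕ} {lam mu : Fin d → ℕ}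

/-- `ω(L^u_{<a})_k`: the number of `k`'s among the unbarred entries of `L` read strictly
before the `μ`-cell `a` in the unbarred column word (all of `λ` is read before `μ`). -/
def countBefore (L : SkewBarredTableau d lam mu) (a : ℕ × ℕ) (k : ℕ) : ℕ :=
  ((cells d lam).filter fun b => L.top b = k).card +
  ((cells d mu).filter fun b => ¬ L.barred b ∧ L.bot b = k ∧ revBefore a b).card

/-- `ω(L^u_{≤a})_k`: as `countBefore`, but the entry of `a` itself is also counted when
`a` is unbarred. -/
def countUpTo (L : SkewBarredTableau d lam mu) (a : ℕ × ℕ) (k : ℕ) : ℕ :=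
  ((cells d lam).filter fun b => L.top b = k).card +
  ((cells d mu).filter fun b => ¬ L.barred b ∧ L.bot b = k ∧ (revBefore a b ∨ b = a)).card

/-- Prefix content within the `λ`-part of the word. -/
def topCountUpTo (L : SkewBarredTableau d lam mu) (a : ℕ × ℕ) (k : ℕ) : ℕ :=
  ((cells d lam).filter fun b => L.top b = k ∧ (youngBefore a b ∨ b = a)).card

/-- `ω(L^u)_k`: total content of the unbarred column word of `L`. -/
def content (L : SkewBarredTableau d lam mu) (k : ℕ) : ℕ :=
  ((cells d lam).filter fun b => L.top b = k).card +
  ((cells d mu).filter fun b => ¬ L.barred b ∧ L.bot b = k).card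

/-- The unbarred column word of `L` is Yamanouchi: every prefix contains at least as
many `k`'s as `(k+1)`'s, for every `k ≥ 1`. -/
def Yamanouchi (L : SkewBarredTableau d lam mu) : Prop :=
  (∀ a ∈ cells d lam, ∀ k : ℕ, 1 ≤ k → L.topCountUpTo a (k + 1) ≤ L.topCountUpTo a k) ∧
  (∀ a ∈ cells d mu, ¬ L.barred a → ∀ k : ℕ, 1 ≤ k →
      L.countUpTo a (k + 1) ≤ L.countUpTo a k)

/-- `L` is an equivariant Littlewood–Richardson skew tableau of shape `λ*μ` and unbarred
content `ν`. -/
def IsLR (L : SkewBarredTableau d lam mu) (ν : Fin d → ℕ) : Prop :=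
  L.Yamanouchi ∧ ∀ i : Fin d, L.content ((i : ℕ) + 1) = ν i

/-- The index `|a|' + ω(L^u_{<a})_{|a|}` of the first `y` in the factor of `c_L` at a
barred cell `a`. -/
def eIdx (L : SkewBarredTableau d lam mu) (a : ℕ × ℕ) : ℤ :=
  ((d : ℤ) + 1 - (L.bot a : ℤ)) + (L.countBefore a (L.bot a) : ℤ)

/-- The index `|a|' + c(a) - r(a)` of the second `y` in the factor of `c_L` at a barred
cell `a`. -/
def fIdx (L : SkewBarredTableau d lam mu) (a : ℕ × ℕ) : ℤ :=
  ((d : ℤ) + 1 - (L.bot a : ℤ)) + (a.2 : ℤ) - (a.1 : ℤ)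

/-- The weight `c_L = ∏_{a barred} (y_{|a|'+ω(L^u_{<a})_{|a|}} - y_{|a|'+c(a)-r(a)})`. -/
def cWt (L : SkewBarredTableau d lam mu) : P d :=
  ∏ a ∈ (cells d mu).filter (fun a => L.barred a), (yI d (L.eIdx a) - yI d (L.fIdx a))

/-- `Δ(a) = ω(L^u_{≤a})_{|a|} - c(a) + r(a)`. -/
def Δ (L : SkewBarredTableau d lam mu) (a : ℕ × ℕ) : ℤ :=
  (L.countUpTo a (L.bot a) : ℤ) - ((a.2 : ℤ) + 1) + ((a.1 : ℤ) + 1)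

end SkewBarredTableau

/-! ### Reverse barred tableaux -/

/-- A reverse barred tableau of shape `μ`. -/
structure RevBarredTableau (d : ℕ) (μ : Fin d → ℕ) where
  val : ℕ × ℕ → ℕ
  barred : ℕ × ℕ → Prop
  mem : ∀ a ∈ cells d μ, 1 ≤ val a ∧ val a ≤ d
  zero : ∀ a ∉ cells d μ, val a = 0
  barred_sub : ∀ a, barred a → a ∈ cells d μ
  row : ∀ r c : ℕ, (r, c + 1) ∈ cells d μ → val (r, c + 1) ≤ val (r, c)
  col : ∀ r c : ℕ, (r + 1, c) ∈ cells d μ → val (r + 1, c) < val (r, c)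

namespace RevBarredTableau

variable {d : ℕ} {μ : Fin d → ℕ}

/-- `ω(B^u_{<a})_k`. -/
def countBefore (B : RevBarredTableau d μ) (a : ℕ × ℕ) (k : ℕ) : ℕ :=
  ((cells d μ).filter fun b => ¬ B.barred b ∧ B.val b = k ∧ revBefore a b).card

/-- `ω(B^u_{≤a})_k` (including `a` itself when unbarred). -/
def countUpTo (B : RevBarredTableau d μ) (a : ℕ × ℕ) (k : ℕ) : ℕ :=
  ((cells d μ).filter fun b => ¬ B.barred b ∧ B.val b = k ∧ (revBefore a b ∨ b = a)).card

/-- `ω(B^u)_k`. -/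
def content (B : RevBarredTableau d μ) (k : ℕ) : ℕ :=
  ((cells d μ).filter fun b => ¬ B.barred b ∧ B.val b = k).card

/-- `e_{ξ,B}(a) = (ξ + ω(B^u_{<a}))_{|a|}`. -/
def eIdx (B : RevBarredTableau d μ) (ξ : Fin d → ℕ) (a : ℕ × ℕ) : ℤ :=
  (vecAt ξ (B.val a) : ℤ) + (B.countBefore a (B.val a) : ℤ)

/-- `f_B(a) = |a|' + c(a) - r(a)`. -/
def fIdx (B : RevBarredTableau d μ) (a : ℕ × ℕ) : ℤ :=
  ((d : ℤ) + 1 - (B.val a : ℤ)) + (a.2 : ℤ) - (a.1 : ℤ)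

/-- `c_{ξ,B} = ∏_{a barred} (y_{e_{ξ,B}(a)} - y_{f_B(a)})`. -/
def cXi (B : RevBarredTableau d μ) (ξ : Fin d → ℕ) : P d :=
  ∏ a ∈ (cells d μ).filter (fun a => B.barred a), (yI d (B.eIdx ξ a) - yI d (B.fIdx a))

/-- The unbarred column word of `λ*B` is Yamanouchi (the `λ`-part is the canonical
filling of `λ`, whose whole content `λ` is added to every prefix of `B^u`). -/
def StarYam (B : RevBarredTableau d μ) (lam : Fin d → ℕ) : Prop :=
  ∀ a ∈ cells d μ, ¬ B.barred a → ∀ k : ℕ, 1 ≤ k →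
    vecAt lam (k + 1) + B.countUpTo a (k + 1) ≤ vecAt lam k + B.countUpTo a k

end RevBarredTableau

/-! ### Reverse hatted tableaux -/

/-- A hat decoration: none, left hat, or right hat. -/
inductive Hat where
  | unhatted : Hat
  | left : Hat
  | right : Hat
deriving DecidableEq

/-- A reverse hatted tableau of shape `μ`. -/
structure RevHattedTableau (d : ℕ) (μ : Fin d → ℕ) where
  val : ℕ × ℕ → ℕ
  hat : ℕ × ℕ → Hat
  mem : ∀ a ∈ cells d μ, 1 ≤ val a ∧ val a ≤ d
  zero : ∀ a ∉ cells d μ, val a = 0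
  hat_out : ∀ a ∉ cells d μ, hat a = Hat.unhatted
  row : ∀ r c : ℕ, (r, c + 1) ∈ cells d μ → val (r, c + 1) ≤ val (r, c)
  col : ∀ r c : ℕ, (r + 1, c) ∈ cells d μ → val (r + 1, c) < val (r, c)

namespace RevHattedTableau

variable {d : ℕ} {μ : Fin d → ℕ}

/-- `ω(H^u_{<a})_k`: content of the unhatted column word of `H` read before `a`. -/
def countBefore (H : RevHattedTableau d μ) (a : ℕ × ℕ) (k : ℕ) : ℕ :=
  ((cells d μ).filter fun b => H.hat b = Hat.unhatted ∧ H.val b = k ∧ revBefore a b).card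

/-- `ω(H^u)_k`. -/
def content (H : RevHattedTableau d μ) (k : ℕ) : ℕ :=
  ((cells d μ).filter fun b => H.hat b = Hat.unhatted ∧ H.val b = k).card

/-- `e_{ξ,H}(a) = (ξ + ω(H^u_{<a}))_{|a|}`. -/
def eIdx (H : RevHattedTableau d μ) (ξ : Fin d → ℕ) (a : ℕ × ℕ) : ℤ :=
  (vecAt ξ (H.val a) : ℤ) + (H.countBefore a (H.val a) : ℤ)

/-- `f_H(a) = |a|' + c(a) - r(a)`. -/
def fIdx (H : RevHattedTableau d μ) (a : ℕ × ℕ) : ℤ :=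
  ((d : ℤ) + 1 - (H.val a : ℤ)) + (a.2 : ℤ) - (a.1 : ℤ)

/-- `d_{ξ,H} = ∏_{a ∈ H^l} y_{e_{ξ,H}(a)} · ∏_{a ∈ H^r} (-y_{f_H(a)})`. -/
def dWt (H : RevHattedTableau d μ) (ξ : Fin d → ℕ) : P d :=
  (∏ a ∈ (cells d μ).filter (fun a => H.hat a = Hat.left), yI d (H.eIdx ξ a)) *
  ∏ a ∈ (cells d μ).filter (fun a => H.hat a = Hat.right), (-(yI d (H.fIdx a)))

end RevHattedTableau

/-- `H̄ = B`: `H` unbars to the reverse barred tableau `B`. -/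
def UnbarsTo {d : ℕ} {μ : Fin d → ℕ} (H : RevHattedTableau d μ)
    (B : RevBarredTableau d μ) : Prop :=
  H.val = B.val ∧ ∀ a, (H.hat a ≠ Hat.unhatted ↔ B.barred a)

/-- The simple transposition `σ_i` on values: exchanges `i` and `i+1`. -/
def swapVal (i v : ℕ) : ℕ := if v = i then i + 1 else if v = i + 1 then i else v

/-- The action of `σ_i` on `ℕ^d` by permuting coordinates. -/
def swapVec {d : ℕ} (i : ℕ) (ξ : Fin d → ℕ) : Fin d → ℕ :=
  fun j => vecAt ξ (swapVal i ((j : ℕ) + 1))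

/-! ### Reverse (barred) subtableaux -/

/-- A reverse subtableau of shape `μ`: each cell is empty (value `0`) or carries a value
in `{1,…,d}`; no row or column conditions. -/
structure RevSubTableau (d : ℕ) (μ : Fin d → ℕ) where
  val : ℕ × ℕ → ℕ
  mem : ∀ a ∈ cells d μ, val a ≤ d
  zero : ∀ a ∉ cells d μ, val a = 0

/-- A reverse barred subtableau of shape `μ`: a reverse subtableau some of whose filled
cells are barred. -/
structure RevBarredSubTableau (d : ℕ) (μ : Fin d → ℕ) where
  val : ℕ × ℕ → ℕ
  barred : ℕ × ℕ → Prop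
  mem : ∀ a ∈ cells d μ, val a ≤ d
  zero : ∀ a ∉ cells d μ, val a = 0
  barred_filled : ∀ a, barred a → a ∈ cells d μ ∧ val a ≠ 0

/-- `(x|y)^R` for a reverse subtableau `R`. -/
def RevSubTableau.xyProd {d : ℕ} {μ : Fin d → ℕ} (R : RevSubTableau d μ) : P d :=
  ∏ a ∈ (cells d μ).filter (fun a => R.val a ≠ 0), factor d (R.val a) a

namespace RevBarredSubTableau

variable {d : ℕ} {μ : Fin d → ℕ}

/-- `ω(B^u_{<a})_k`: unbarred filled entries of value `k` read before `a`. -/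
def countBefore (B : RevBarredSubTableau d μ) (a : ℕ × ℕ) (k : ℕ) : ℕ :=
  ((cells d μ).filter fun b => ¬ B.barred b ∧ B.val b = k ∧ revBefore a b).card

/-- `ω(B^u)_k`. -/
def content (B : RevBarredSubTableau d μ) (k : ℕ) : ℕ :=
  ((cells d μ).filter fun b => ¬ B.barred b ∧ B.val b = k).card

/-- `e_{ξ,B}(a) = (ξ + ω(B^u_{<a}))_{|a|}`. -/
def eIdx (B : RevBarredSubTableau d μ) (ξ : Fin d → ℕ) (a : ℕ × ℕ) : ℤ :=
  (vecAt ξ (B.val a) : ℤ) + (B.countBefore a (B.val a) : ℤ)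

/-- `f_B(a) = |a|' + c(a) - r(a)`. -/
def fIdx (B : RevBarredSubTableau d μ) (a : ℕ × ℕ) : ℤ :=
  ((d : ℤ) + 1 - (B.val a : ℤ)) + (a.2 : ℤ) - (a.1 : ℤ)

/-- `c_{ξ,B}`. -/
def cXi (B : RevBarredSubTableau d μ) (ξ : Fin d → ℕ) : P d :=
  ∏ a ∈ (cells d μ).filter (fun a => B.barred a), (yI d (B.eIdx ξ a) - yI d (B.fIdx a))

end RevBarredSubTableau

end EqLR

namespace EqLR

/-! ### Lower-degree terms -/

/-- The polynomials all of whose monomials have `x`-degree in `s`. -/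
def xDegIn (d : ℕ) (s : Set ℕ) : Submodule ℂ (P d) :=
  restrictSupport ℂ {m | (∑ j : Fin d, m (Sum.inl j)) ∈ s}

theorem mem_xDegIn {d : ℕ} {s : Set ℕ} {p : P d} :
    p ∈ xDegIn d s ↔ ∀ m ∈ p.support, (∑ j : Fin d, m (Sum.inl j)) ∈ s :=
  Iff.rfl

theorem mul_mem_xDegIn {d : ℕ} {s t u : Set ℕ} (h : ∀ a ∈ s, ∀ b ∈ t, a + b ∈ u) {p q : P d}
    (hp : p ∈ xDegIn d s) (hq : q ∈ xDegIn d t) : p * q ∈ xDegIn d u := by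
  rw [mem_xDegIn] at *
  intro _ hm
  obtain ⟨a, ha, b, hb, rfl⟩ := Finset.mem_add.1 (support_mul p q hm)
  simpa [Finset.sum_add_distrib] using h _ (hp a ha) _ (hq b hb)

theorem xDegIn_mono {d : ℕ} {s t : Set ℕ} (h : s ⊆ t) : xDegIn d s ≤ xDegIn d t :=
  fun _ hp _ hm => h (hp hm)

theorem X_inl_mem_xDegIn {d : ℕ} (j : Fin d) : (X (Sum.inl j) : P d) ∈ xDegIn d (Set.Iic 1) := by
  rw [mem_xDegIn]
  intro m hm
  rw [support_X, Finset.mem_singleton] at hm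
  subst hm
  simp [Finsupp.single_apply]

theorem yI_mem_xDegIn (d : ℕ) (i : ℤ) : yI d i ∈ xDegIn d (Set.Iio 1) := by
  rw [mem_xDegIn]
  intro m hm
  rw [yI, support_X, Finset.mem_singleton] at hm
  subst hm
  simp

theorem xv_mem_xDegIn (d v : ℕ) : xv d v ∈ xDegIn d (Set.Iic 1) := by
  unfold xv
  split_ifs
  · exact X_inl_mem_xDegIn _
  · exact zero_mem _

theorem factor_mem_xDegIn (d v : ℕ) (a : ℕ × ℕ) : factor d v a ∈ xDegIn d (Set.Iic 1) := by
  unfold factor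
  exact sub_mem (xv_mem_xDegIn d v) (xDegIn_mono Set.Iio_subset_Iic_self (yI_mem_xDegIn d _))

theorem prod_mem_xDegIn {d : ℕ} {ι : Type*} (s : Finset ι) (f : ι → P d)
    (hf : ∀ a ∈ s, f a ∈ xDegIn d (Set.Iic 1)) :
    ∏ a ∈ s, f a ∈ xDegIn d (Set.Iic s.card) := by
  induction s using Finset.induction_on with
  | empty =>
    rw [mem_xDegIn]
    intro m hm
    rw [Finset.prod_empty, support_one, Finset.mem_singleton] at hm
    subst hm
    simp
  | insert a s ha ih =>
    rw [Finset.prod_insert ha, Finset.card_insert_of_notMem ha]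
    refine mul_mem_xDegIn ?_ (hf a (Finset.mem_insert_self a s))
      (ih fun b hb => hf b (Finset.mem_insert_of_mem hb))
    intro a ha b hb
    simp only [Set.mem_Iic] at *
    omega

theorem prod_sub_prod_mem_xDegIn {d : ℕ} {ι : Type*} (s : Finset ι) (f g : ι → P d)
    (hf : ∀ a ∈ s, f a ∈ xDegIn d (Set.Iic 1)) (hg : ∀ a ∈ s, g a ∈ xDegIn d (Set.Iic 1))
    (hfg : ∀ a ∈ s, f a - g a ∈ xDegIn d (Set.Iio 1)) :
    ∏ a ∈ s, f a - ∏ a ∈ s, g a ∈ xDegIn d (Set.Iio s.card) := by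
  induction s using Finset.induction_on with
  | empty => simp
  | insert a s ha ih =>
    rw [Finset.prod_insert ha, Finset.prod_insert ha, Finset.card_insert_of_notMem ha]
    rw [show f a * ∏ b ∈ s, f b - g a * ∏ b ∈ s, g b =
      f a * (∏ b ∈ s, f b - ∏ b ∈ s, g b) + (f a - g a) * ∏ b ∈ s, g b by ring]
    refine add_mem (mul_mem_xDegIn ?_ (hf a (Finset.mem_insert_self a s))
      (ih (fun b hb => hf b (Finset.mem_insert_of_mem hb))
        (fun b hb => hg b (Finset.mem_insert_of_mem hb))
        (fun b hb => hfg b (Finset.mem_insert_of_mem hb))))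
      (mul_mem_xDegIn ?_ (hfg a (Finset.mem_insert_self a s))
        (prod_mem_xDegIn s g fun b hb => hg b (Finset.mem_insert_of_mem hb)))
    all_goals
      intro a ha b hb
      simp only [Set.mem_Iic, Set.mem_Iio] at *
      omega

/-! ### Cells and tableaux -/

theorem mem_cells {d : ℕ} {μ : Fin d → ℕ} {r c : ℕ} :
    (r, c) ∈ cells d μ ↔ ∃ h : r < d, c < μ ⟨r, h⟩ := by
  simp only [cells, Finset.mem_filter, Finset.mem_product, Finset.mem_range]
  refine ⟨fun h => h.2, fun ⟨h, hc⟩ => ⟨⟨h, ?_⟩, h, hc⟩⟩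
  exact hc.trans (Nat.lt_succ_of_le (Finset.le_sup (f := μ) (Finset.mem_univ _)))

theorem cells_eq_map (d : ℕ) (μ : Fin d → ℕ) :
    cells d μ = (Finset.univ.sigma fun r : Fin d => Finset.range (μ r)).map
      ⟨fun a => ((a.1 : ℕ), a.2), fun a b h => by
        obtain ⟨r, c⟩ := a
        obtain ⟨r', c'⟩ := b
        simp only [Prod.mk.injEq, Fin.val_inj] at h
        obtain ⟨rfl, rfl⟩ := h
        rfl⟩ := by
  ext ⟨r, c⟩
  rw [mem_cells]
  simp only [Finset.mem_map, Finset.mem_sigma, Finset.mem_univ, true_and, Finset.mem_range,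
    Sigma.exists]
  constructor
  · rintro ⟨h, hc⟩
    exact ⟨⟨r, h⟩, c, hc, rfl⟩
  · rintro ⟨r', c', hc, h⟩
    obtain ⟨rfl, rfl⟩ := Prod.mk.inj h
    exact ⟨r'.2, hc⟩

theorem card_cells (d : ℕ) (μ : Fin d → ℕ) : (cells d μ).card = wt μ := by
  rw [cells_eq_map, Finset.card_map, Finset.card_sigma]
  simp [wt]

theorem prod_cells {M : Type*} [CommMonoid M] (d : ℕ) (μ : Fin d → ℕ) (f : ℕ × ℕ → M) :
    ∏ a ∈ cells d μ, f a = ∏ r : Fin d, ∏ c ∈ Finset.range (μ r), f ((r : ℕ), c) := by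
  rw [cells_eq_map, Finset.prod_map, Finset.prod_sigma]
  rfl

namespace RevTableau

variable {d : ℕ} {μ : Fin d → ℕ}

theorem val_injective : Function.Injective (RevTableau.val (d := d) (μ := μ)) := by
  rintro ⟨v, _, _, _, _⟩ ⟨w, _, _, _, _⟩ h
  cases h
  rfl

theorem val_le (R : RevTableau d μ) (a : ℕ × ℕ) : R.val a ≤ d := by
  by_cases h : a ∈ cells d μ
  · exact (R.mem a h).2
  · simp [R.zero a h]

instance : Finite (RevTableau d μ) := by
  refine Finite.of_injective
    (fun (R : RevTableau d μ) (a : cells d μ) =>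
      (⟨R.val a, Nat.lt_succ_of_le (R.val_le a)⟩ : Fin (d + 1)))
    fun R S h => val_injective (funext fun a => ?_)
  by_cases ha : a ∈ cells d μ
  · simpa using congrFun h ⟨a, ha⟩
  · rw [R.zero a ha, S.zero a ha]

instance : Fintype (RevTableau d μ) := Fintype.ofFinite _

theorem pos_iff (R : RevTableau d μ) (a : ℕ × ℕ) : 0 < R.val a ↔ a ∈ cells d μ := by
  by_cases h : a ∈ cells d μ
  · exact iff_of_true (R.mem a h).1 h
  · simp [h, R.zero a h]

theorem antitone_row (R : RevTableau d μ) (r : ℕ) : Antitone fun c => R.val (r, c) := by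
  refine antitone_nat_of_succ_le fun c => ?_
  by_cases h : (r, c + 1) ∈ cells d μ
  · exact R.row r c h
  · simp [R.zero _ h]

theorem col_lt (R : RevTableau d μ) {r c : ℕ} (h : 0 < R.val (r + 1, c)) :
    R.val (r + 1, c) < R.val (r, c) :=
  R.col r c ((R.pos_iff _).1 h)

theorem exists_val_le (R : RevTableau d μ) (k r : ℕ) : ∃ c, R.val (r, c) ≤ k := by
  refine ⟨Finset.univ.sup μ + 1, ?_⟩
  rw [R.zero]
  · exact Nat.zero_le k
  · simp [cells]

/-- The number of entries of row `r` exceeding `k`. -/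
def numGT (R : RevTableau d μ) (k r : ℕ) : ℕ := Nat.find (R.exists_val_le k r)

theorem lt_numGT (R : RevTableau d μ) {k r c : ℕ} : c < R.numGT k r ↔ k < R.val (r, c) := by
  rw [← not_le, ← not_le, numGT, Nat.find_le_iff, not_iff_not]
  exact ⟨fun ⟨m, hm, h⟩ => (R.antitone_row r hm).trans h, fun h => ⟨c, le_rfl, h⟩⟩

theorem numGT_anti (R : RevTableau d μ) {k l : ℕ} (h : k ≤ l) (r : ℕ) :
    R.numGT l r ≤ R.numGT k r :=
  le_of_forall_lt fun _ hc => R.lt_numGT.2 (h.trans_lt (R.lt_numGT.1 hc))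

theorem numGT_succ_le (R : RevTableau d μ) (k r : ℕ) : R.numGT k (r + 1) ≤ R.numGT (k + 1) r :=
  le_of_forall_lt fun c hc => by
    rw [lt_numGT] at *
    have := R.col_lt (Nat.zero_lt_of_lt hc)
    omega

theorem numGT_eq_zero (R : RevTableau d μ) (k : ℕ) {r : ℕ} (hr : d ≤ r) : R.numGT k r = 0 := by
  refine Nat.eq_zero_of_not_pos fun h => ?_
  rw [lt_numGT] at h
  obtain ⟨h, -⟩ := mem_cells.1 ((R.pos_iff _).1 (Nat.zero_lt_of_lt h))
  omega

/-- The filling obtained from `R` by replacing both `j + 1` and `j + 2` by `j + 1`. -/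
def collapse (R : RevTableau d μ) (j : ℕ) (a : ℕ × ℕ) : ℕ :=
  if R.val a = j + 2 then j + 1 else R.val a

theorem numGT_congr {R S : RevTableau d μ} {j : ℕ} (h : R.collapse j = S.collapse j) {k : ℕ}
    (hk : k ≠ j + 1) (r : ℕ) : R.numGT k r = S.numGT k r := by
  refine eq_of_forall_lt_iff fun c => ?_
  have := congrFun h (r, c)
  unfold collapse at this
  rw [lt_numGT, lt_numGT]
  split_ifs at this <;> omega

/-- Redistribute the entries `j + 1` and `j + 2` of `R`, so that row `r` has `M r` entries
exceeding `j + 1`. -/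
def redistribute (R : RevTableau d μ) (j : ℕ) (hj : j + 1 < d) (M : ℕ → ℕ)
    (hB : ∀ r, R.numGT j (r + 1) ≤ M r) (hA : ∀ r, M (r + 1) ≤ R.numGT (j + 2) r) :
    RevTableau d μ where
  val a := if R.val a = j + 1 ∨ R.val a = j + 2 then
    if a.2 < M a.1 then j + 2 else j + 1 else R.val a
  mem a ha := by
    have := R.mem a ha
    split_ifs <;> omega
  zero a ha := by
    have := R.zero a ha
    rw [if_neg (by omega), this]
  row r c h := by
    have := R.row r c h
    dsimp only
    split_ifs <;> omega
  col r c h := by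
    have h1 := R.col r c h
    have h2 := R.lt_numGT (k := j) (r := r + 1) (c := c)
    have h3 := R.lt_numGT (k := j + 2) (r := r) (c := c)
    have h4 := hB r
    have h5 := hA r
    dsimp only
    split_ifs <;> omega

section redistribute

variable (R : RevTableau d μ) (j : ℕ) (hj : j + 1 < d) (M : ℕ → ℕ)
    (hB : ∀ r, R.numGT j (r + 1) ≤ M r) (hA : ∀ r, M (r + 1) ≤ R.numGT (j + 2) r)

theorem collapse_redistribute :
    (R.redistribute j hj M hB hA).collapse j = R.collapse j := by
  funext a
  simp only [collapse, redistribute]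
  split_ifs <;> omega

theorem numGT_redistribute {r : ℕ} (h1 : R.numGT (j + 2) r ≤ M r) (h2 : M r ≤ R.numGT j r) :
    (R.redistribute j hj M hB hA).numGT (j + 1) r = M r := by
  refine eq_of_forall_lt_iff fun c => ?_
  have h3 := R.lt_numGT (k := j) (r := r) (c := c)
  have h4 := R.lt_numGT (k := j + 2) (r := r) (c := c)
  rw [lt_numGT]
  simp only [redistribute]
  split_ifs <;> omega

end redistribute

theorem eq_of_collapse_eq {R S : RevTableau d μ} {j : ℕ} (h : R.collapse j = S.collapse j)
    (hM : ∀ r < d, R.numGT (j + 1) r = S.numGT (j + 1) r) : R = S := by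
  refine val_injective (funext fun ⟨r, c⟩ => ?_)
  have h1 := congrFun h (r, c)
  have h2 := R.lt_numGT (k := j + 1) (r := r) (c := c)
  have h3 := S.lt_numGT (k := j + 1) (r := r) (c := c)
  have h4 : R.numGT (j + 1) r = S.numGT (j + 1) r := by
    by_cases hr : r < d
    · exact hM r hr
    · rw [numGT_eq_zero _ _ (not_lt.1 hr), numGT_eq_zero _ _ (not_lt.1 hr)]
  rw [h4] at h2
  unfold collapse at h1
  split_ifs at h1 <;> omega

end RevTableau

theorem fSchur_eq_sum (d : ℕ) (μ : Fin d → ℕ) :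
    fSchur d μ = ∑ R : RevTableau d μ, ∏ a ∈ cells d μ, factor d (R.val a) a :=
  finsum_eq_sum_of_fintype _

theorem schurX_eq_sum (d : ℕ) (μ : Fin d → ℕ) :
    schurX d μ = ∑ R : RevTableau d μ, ∏ a ∈ cells d μ, xv d (R.val a) :=
  finsum_eq_sum_of_fintype _

theorem fSchur_sub_schurX_mem_xDegIn (d : ℕ) (μ : Fin d → ℕ) :
    fSchur d μ - schurX d μ ∈ xDegIn d (Set.Iio (wt μ)) := by
  rw [fSchur_eq_sum, schurX_eq_sum, ← Finset.sum_sub_distrib, ← card_cells]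
  refine sum_mem fun R _ => prod_sub_prod_mem_xDegIn _ _ _ (fun a _ => factor_mem_xDegIn _ _ _)
    (fun a _ => xv_mem_xDegIn _ _) fun a _ => ?_
  rw [factor, sub_sub_cancel_left]
  exact neg_mem (yI_mem_xDegIn _ _)

/-! ### Symmetry -/

/-- The factorial complete symmetric polynomial in two variables, over the interval `[L, U]`. -/
def twoVarSum {A : Type*} [CommRing A] (z : ℕ → A) (L U : ℕ) (x x' : A) : A :=
  ∑ M ∈ Finset.Icc L U,
    (∏ c ∈ Finset.Ico L M, (x - z c)) * ∏ c ∈ Finset.Ico M U, (x' - z (c + 1))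

theorem sub_mul_twoVarSum {A : Type*} [CommRing A] (z : ℕ → A) {L U : ℕ} (h : L ≤ U) (x x' : A) :
    (x - x') * twoVarSum z L U x x' =
      ∏ c ∈ Finset.Ico L (U + 1), (x - z c) - ∏ c ∈ Finset.Ico L (U + 1), (x' - z c) := by
  let F : ℕ → A := fun M =>
    (∏ c ∈ Finset.Ico L M, (x - z c)) * ∏ c ∈ Finset.Ico M (U + 1), (x' - z c)
  have hF : ∀ M ∈ Finset.Ico L (U + 1), (x - x') * ((∏ c ∈ Finset.Ico L M, (x - z c)) *
      ∏ c ∈ Finset.Ico M U, (x' - z (c + 1))) = F (M + 1) - F M := by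
    intro M hM
    rw [Finset.mem_Ico] at hM
    simp only [F]
    rw [Finset.prod_Ico_succ_top hM.1, Finset.prod_eq_prod_Ico_succ_bot hM.2 (fun c => x' - z c),
      Finset.prod_Ico_add' (fun c => x' - z c) M U 1]
    ring
  rw [twoVarSum, Finset.mul_sum, ← Finset.Ico_add_one_right_eq_Icc, Finset.sum_congr rfl hF,
    Finset.sum_Ico_sub F (by omega)]
  simp [F]

theorem twoVarSum_comm {A : Type*} [CommRing A] [IsDomain A] (z : ℕ → A) (L U : ℕ) {x x' : A}
    (hx : x ≠ x') : twoVarSum z L U x x' = twoVarSum z L U x' x := by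
  rcases le_or_gt L U with h | h
  · refine mul_left_cancel₀ (sub_ne_zero.2 hx) ?_
    rw [sub_mul_twoVarSum z h, ← neg_sub x' x, neg_mul, sub_mul_twoVarSum z h, neg_sub]
  · simp [twoVarSum, Finset.Icc_eq_empty_of_lt h]

theorem map_twoVarSum {A B : Type*} [CommRing A] [CommRing B] (φ : A →+* B) (z : ℕ → A)
    (L U : ℕ) (x x' : A) :
    φ (twoVarSum z L U x x') = twoVarSum (fun c => φ (z c)) L U (φ x) (φ x') := by
  simp [twoVarSum]

namespace RevTableau

variable {d : ℕ} {μ : Fin d → ℕ}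

/-- The contribution to `(x|y)^R` of the entries other than `j + 1` and `j + 2`. -/
def fixedProd (R : RevTableau d μ) (j : ℕ) : P d :=
  ∏ a ∈ (cells d μ).filter (fun a => ¬ R.collapse j a = j + 1), factor d (R.collapse j a) a

theorem prod_factor_eq (R : RevTableau d μ) (j : ℕ) :
    ∏ a ∈ cells d μ, factor d (R.val a) a = R.fixedProd j *
      ∏ r : Fin d, ((∏ c ∈ Finset.Ico (R.numGT (j + 2) r) (R.numGT (j + 1) r),
          factor d (j + 2) (r, c)) *
        ∏ c ∈ Finset.Ico (R.numGT (j + 1) r) (R.numGT j r), factor d (j + 1) (r, c)) := by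
  rw [← Finset.prod_filter_mul_prod_filter_not (cells d μ) (fun a => R.collapse j a = j + 1),
    mul_comm]
  congr 1
  · refine Finset.prod_congr rfl fun a ha => ?_
    have := (Finset.mem_filter.1 ha).2
    unfold collapse at this ⊢
    split_ifs at this ⊢
    · omega
    · rfl
  · rw [Finset.prod_filter, prod_cells]
    refine Finset.prod_congr rfl fun r _ => ?_
    have hfree : (Finset.range (μ r)).filter (fun c => R.collapse j (r, c) = j + 1) =
        Finset.Ico (R.numGT (j + 2) r) (R.numGT j r) := by
      ext c
      have h1 := R.lt_numGT (k := j) (r := r) (c := c)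
      have h2 := R.lt_numGT (k := j + 2) (r := r) (c := c)
      have h3 : 0 < R.val (r, c) ↔ c < μ r := by
        rw [pos_iff, mem_cells]
        exact ⟨fun ⟨_, h⟩ => h, fun h => ⟨r.2, h⟩⟩
      rw [Finset.mem_filter, Finset.mem_range, Finset.mem_Ico, collapse]
      split_ifs <;> omega
    rw [← Finset.prod_filter, hfree,
      ← Finset.prod_Ico_consecutive _ (R.numGT_anti (Nat.le_succ (j + 1)) r)
        (R.numGT_anti (Nat.le_succ j) r)]
    congr 1
    all_goals
      refine Finset.prod_congr rfl fun c hc => ?_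
      have h1 := R.lt_numGT (k := j) (r := r) (c := c)
      have h2 := R.lt_numGT (k := j + 1) (r := r) (c := c)
      have h3 := R.lt_numGT (k := j + 2) (r := r) (c := c)
      rw [Finset.mem_Ico] at hc
      congr 1
      omega

/-- The least number of entries exceeding `j + 1` in row `r`, over all tableaux with the same
collapse as `R`. -/
def lowerEnd (R : RevTableau d μ) (j r : ℕ) : ℕ := max (R.numGT (j + 2) r) (R.numGT j (r + 1))

/-- The greatest number of entries exceeding `j + 1` in row `r`, over all tableaux with the same
collapse as `R`. -/
def upperEnd (R : RevTableau d μ) (j : ℕ) : ℕ → ℕ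
  | 0 => R.numGT j 0
  | r + 1 => min (R.numGT j (r + 1)) (R.numGT (j + 2) r)

theorem le_lowerEnd (R : RevTableau d μ) (j r : ℕ) : R.numGT (j + 2) r ≤ R.lowerEnd j r :=
  le_max_left _ _

theorem upperEnd_le (R : RevTableau d μ) (j r : ℕ) : R.upperEnd j r ≤ R.numGT j r := by
  cases r with
  | zero => exact le_rfl
  | succ r => exact min_le_left _ _

theorem numGT_mem_Icc {R S : RevTableau d μ} {j : ℕ} (h : R.collapse j = S.collapse j) (r : ℕ) :
    R.numGT (j + 1) r ∈ Finset.Icc (S.lowerEnd j r) (S.upperEnd j r) := by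
  rw [Finset.mem_Icc, lowerEnd, ← numGT_congr h (by omega), ← numGT_congr h (by omega)]
  refine ⟨max_le (R.numGT_anti (by omega) r) (R.numGT_succ_le j r), ?_⟩
  cases r with
  | zero =>
    rw [upperEnd, ← numGT_congr h (by omega)]
    exact R.numGT_anti (by omega) 0
  | succ r =>
    rw [upperEnd, ← numGT_congr h (by omega), ← numGT_congr h (by omega)]
    exact le_min (R.numGT_anti (by omega) _) (R.numGT_succ_le (j + 1) r)

theorem exists_numGT_eq (R : RevTableau d μ) {j : ℕ} (hj : j + 1 < d) {M : Fin d → ℕ}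
    (hM : ∀ r : Fin d, M r ∈ Finset.Icc (R.lowerEnd j r) (R.upperEnd j r)) :
    ∃ S : RevTableau d μ, S.collapse j = R.collapse j ∧
      ∀ r : Fin d, S.numGT (j + 1) r = M r := by
  let N : ℕ → ℕ := fun r => if h : r < d then M ⟨r, h⟩ else 0
  have hN : ∀ r, R.lowerEnd j r ≤ N r ∧ N r ≤ R.upperEnd j r := by
    intro r
    by_cases h : r < d
    · simpa [N, h] using hM ⟨r, h⟩
    · have h0 : R.lowerEnd j r = 0 := by
        rw [lowerEnd, numGT_eq_zero _ _ (by omega), numGT_eq_zero _ _ (by omega), max_self]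
      simp [N, h, h0]
  refine ⟨R.redistribute j hj N (fun r => (le_max_right _ _).trans (hN r).1)
    (fun r => (hN (r + 1)).2.trans (min_le_right _ _)), R.collapse_redistribute _ _ _ _ _,
    fun r => ?_⟩
  rw [numGT_redistribute _ _ _ _ _ _ ((R.le_lowerEnd j r).trans (hN r).1)
    ((hN r).2.trans (R.upperEnd_le j r))]
  simp [N]

/-- The contribution to `(x|y)^R` of the columns containing both `j + 1` and `j + 2`. -/
def pairProd (R : RevTableau d μ) (j : ℕ) : P d :=
  ∏ r ∈ Finset.range (d - 1), ∏ c ∈ Finset.Ico (R.numGT (j + 2) r) (R.numGT j (r + 1)),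
    factor d (j + 2) (r, c) * factor d (j + 1) (r + 1, c)

theorem prod_paired_eq (R : RevTableau d μ) (j : ℕ) :
    ∏ r : Fin d, ((∏ c ∈ Finset.Ico (R.numGT (j + 2) r) (R.lowerEnd j r),
          factor d (j + 2) (r, c)) *
        ∏ c ∈ Finset.Ico (R.upperEnd j r) (R.numGT j r), factor d (j + 1) (r, c)) =
      R.pairProd j := by
  rw [Finset.prod_mul_distrib,
    Fin.prod_univ_eq_prod_range (fun r => ∏ c ∈ Finset.Ico (R.numGT (j + 2) r) (R.lowerEnd j r),
      factor d (j + 2) (r, c)),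
    Fin.prod_univ_eq_prod_range (fun r => ∏ c ∈ Finset.Ico (R.upperEnd j r) (R.numGT j r),
      factor d (j + 1) (r, c)), pairProd]
  rcases Nat.eq_zero_or_pos d with hd | hd
  · simp [hd]
  have hrow : ∀ r, Finset.Ico (R.numGT (j + 2) r) (R.lowerEnd j r) =
      Finset.Ico (R.numGT (j + 2) r) (R.numGT j (r + 1)) := by
    intro r
    ext c
    simp only [Finset.mem_Ico, lowerEnd]
    omega
  have hrow' : ∀ r, Finset.Ico (R.upperEnd j (r + 1)) (R.numGT j (r + 1)) =
      Finset.Ico (R.numGT (j + 2) r) (R.numGT j (r + 1)) := by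
    intro r
    ext c
    simp only [Finset.mem_Ico, upperEnd]
    omega
  have htop : R.numGT j (d - 1 + 1) = 0 := R.numGT_eq_zero j (by omega)
  have hrange : Finset.range d = Finset.range (d - 1 + 1) := by
    rw [Nat.sub_add_cancel hd]
  rw [hrange, Finset.prod_range_succ, Finset.prod_range_succ' _ (d - 1)]
  simp only [hrow, hrow', htop, Finset.prod_mul_distrib]
  simp [upperEnd]

/-- The `y` variable attached to an entry `j + 2` in the cell `(r, c)`. -/
def yShift (d j r c : ℕ) : P d := yI d ((d : ℤ) - 1 - j + c - r)

theorem factor_add_two (d j r c : ℕ) :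
    factor d (j + 2) (r, c) = xv d (j + 2) - yShift d j r c := by
  rw [factor, yShift]
  congr 2
  push_cast
  ring

theorem factor_add_one (d j r c : ℕ) :
    factor d (j + 1) (r, c) = xv d (j + 1) - yShift d j r (c + 1) := by
  rw [factor, yShift]
  congr 2
  push_cast
  ring

theorem factor_add_one_succ (d j r c : ℕ) :
    factor d (j + 1) (r + 1, c) = xv d (j + 1) - yShift d j r c := by
  rw [factor, yShift]
  congr 2
  push_cast
  ring

theorem prod_Ico_mul_prod_Ico {A : Type*} [CommMonoid A] (f g : ℕ → A) {a l m u b : ℕ}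
    (hal : a ≤ l) (hlm : l ≤ m) (hmu : m ≤ u) (hub : u ≤ b) :
    (∏ c ∈ Finset.Ico a m, f c) * ∏ c ∈ Finset.Ico m b, g c =
      ((∏ c ∈ Finset.Ico a l, f c) * ∏ c ∈ Finset.Ico u b, g c) *
        ((∏ c ∈ Finset.Ico l m, f c) * ∏ c ∈ Finset.Ico m u, g c) := by
  rw [← Finset.prod_Ico_consecutive f hal hlm, ← Finset.prod_Ico_consecutive g hmu hub]
  ac_rfl

theorem sum_collapse_eq (R : RevTableau d μ) {j : ℕ} (hj : j + 1 < d) :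
    ∑ S : RevTableau d μ with S.collapse j = R.collapse j,
        ∏ a ∈ cells d μ, factor d (S.val a) a =
      R.fixedProd j * R.pairProd j * ∏ r : Fin d,
        twoVarSum (yShift d j r) (R.lowerEnd j r) (R.upperEnd j r) (xv d (j + 2))
          (xv d (j + 1)) := by
  simp only [twoVarSum]
  rw [Finset.prod_univ_sum, Finset.mul_sum]
  refine Finset.sum_bij (fun S _ r => S.numGT (j + 1) r) ?_ ?_ ?_ ?_
  · intro S hS
    rw [Fintype.mem_piFinset]
    exact fun r => numGT_mem_Icc (Finset.mem_filter.1 hS).2 r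
  · intro S hS T hT h
    exact eq_of_collapse_eq ((Finset.mem_filter.1 hS).2.trans (Finset.mem_filter.1 hT).2.symm)
      fun r hr => congrFun h ⟨r, hr⟩
  · intro M hM
    obtain ⟨S, hS, hSM⟩ := R.exists_numGT_eq hj (Fintype.mem_piFinset.1 hM)
    exact ⟨S, by simpa using hS, funext hSM⟩
  · intro S hS
    have hS' : S.collapse j = R.collapse j := (Finset.mem_filter.1 hS).2
    have hfixed : S.fixedProd j = R.fixedProd j := by rw [fixedProd, fixedProd, hS']
    have hrow : ∀ r : Fin d, _ := fun r =>
      prod_Ico_mul_prod_Ico (fun c => factor d (j + 2) (r, c)) (fun c => factor d (j + 1) (r, c))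
        (R.le_lowerEnd j r) (Finset.mem_Icc.1 (numGT_mem_Icc hS' r)).1
        (Finset.mem_Icc.1 (numGT_mem_Icc hS' r)).2 (R.upperEnd_le j r)
    rw [S.prod_factor_eq j, hfixed, mul_assoc]
    congr 1
    simp only [numGT_congr hS' (by omega : j + 2 ≠ j + 1), numGT_congr hS' (by omega : j ≠ j + 1)]
    rw [Finset.prod_congr rfl fun r _ => hrow r, Finset.prod_mul_distrib, R.prod_paired_eq j]
    simp only [factor_add_two, factor_add_one]

end RevTableau

/-- Exchange of the variables `x_{j+1}` and `x_{j+2}`. -/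
def swapX {d j : ℕ} (hj : j + 1 < d) : P d →ₐ[ℂ] P d :=
  rename (Equiv.sumCongr (Equiv.swap (⟨j, by omega⟩ : Fin d) ⟨j + 1, hj⟩) (Equiv.refl ℤ))

section swapX

variable {d j : ℕ} (hj : j + 1 < d)

theorem swapX_yI (i : ℤ) : swapX hj (yI d i) = yI d i := by
  rw [swapX, yI, rename_X, Equiv.sumCongr_apply, Sum.map_inr, Equiv.refl_apply]

theorem swapX_xv_add_one : swapX hj (xv d (j + 1)) = xv d (j + 2) := by
  have h : j < d := by omega
  simp [swapX, xv, hj, h, -Equiv.Perm.sumCongr_swap_refl]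

theorem swapX_xv_add_two : swapX hj (xv d (j + 2)) = xv d (j + 1) := by
  have h : j < d := by omega
  simp [swapX, xv, hj, h, -Equiv.Perm.sumCongr_swap_refl]

theorem swapX_xv_of_ne {v : ℕ} (h0 : 1 ≤ v) (h1 : v ≠ j + 1) (h2 : v ≠ j + 2) :
    swapX hj (xv d v) = xv d v := by
  unfold xv
  split_ifs with h
  · rw [swapX, rename_X, Equiv.sumCongr_apply, Sum.map_inl, Equiv.swap_apply_of_ne_of_ne]
    all_goals
      simp only [ne_eq, Fin.mk.injEq]
      omega
  · exact map_zero _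

theorem xv_add_two_ne_xv_add_one {d j : ℕ} (hj : j + 1 < d) : xv d (j + 2) ≠ xv d (j + 1) := by
  have h : j < d := by omega
  simp [xv, hj, h, X_injective.eq_iff]

theorem swapX_fixedProd {μ : Fin d → ℕ} (R : RevTableau d μ) :
    swapX hj (R.fixedProd j) = R.fixedProd j := by
  rw [RevTableau.fixedProd, map_prod]
  refine Finset.prod_congr rfl fun a ha => ?_
  rw [Finset.mem_filter] at ha
  have h0 := (R.mem a ha.1).1
  rw [factor, map_sub, swapX_yI, swapX_xv_of_ne hj _ ha.2]
  all_goals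
    unfold RevTableau.collapse
    split_ifs <;> omega

theorem swapX_pairProd {μ : Fin d → ℕ} (R : RevTableau d μ) :
    swapX hj (R.pairProd j) = R.pairProd j := by
  simp only [RevTableau.pairProd, RevTableau.factor_add_two, RevTableau.factor_add_one_succ,
    map_prod, map_mul, map_sub, swapX_xv_add_one, swapX_xv_add_two, RevTableau.yShift, swapX_yI]
  exact Finset.prod_congr rfl fun _ _ => Finset.prod_congr rfl fun _ _ => mul_comm _ _

theorem swapX_twoVarSum (r L U : ℕ) :
    swapX hj (twoVarSum (RevTableau.yShift d j r) L U (xv d (j + 2)) (xv d (j + 1))) =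
      twoVarSum (RevTableau.yShift d j r) L U (xv d (j + 2)) (xv d (j + 1)) := by
  rw [twoVarSum_comm _ _ _ (xv_add_two_ne_xv_add_one hj)]
  refine (map_twoVarSum (swapX hj : P d →+* P d) _ _ _ _ _).trans ?_
  simp only [RingHom.coe_coe, RevTableau.yShift, swapX_yI, swapX_xv_add_one, swapX_xv_add_two]
  exact twoVarSum_comm _ _ _ (xv_add_two_ne_xv_add_one hj)

theorem swapX_fSchur (μ : Fin d → ℕ) : swapX hj (fSchur d μ) = fSchur d μ := by
  rw [fSchur_eq_sum, ← Finset.sum_fiberwise_of_maps_to (g := fun R : RevTableau d μ => R.collapse j)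
    (t := Finset.univ.image fun R : RevTableau d μ => R.collapse j)
    (fun R hR => Finset.mem_image_of_mem _ hR), map_sum]
  refine Finset.sum_congr rfl fun κ hκ => ?_
  obtain ⟨R, -, rfl⟩ := Finset.mem_image.1 hκ
  rw [R.sum_collapse_eq hj]
  simp only [map_mul, map_prod, swapX_fixedProd, swapX_pairProd, swapX_twoVarSum]

end swapX

theorem symmX_of_swap {n : ℕ} {p : P (n + 1)}
    (h : ∀ i : Fin n,
      rename (⇑(Equiv.sumCongr (Equiv.swap i.castSucc i.succ) (Equiv.refl ℤ))) p = p) :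
    SymmX p := by
  intro σ
  have hσ : σ ∈ Submonoid.closure (Set.range fun i : Fin n => Equiv.swap i.castSucc i.succ) := by
    rw [Equiv.Perm.mclosure_swap_castSucc_succ]
    trivial
  induction hσ using Submonoid.closure_induction with
  | mem σ hσ =>
    obtain ⟨i, rfl⟩ := hσ
    exact h i
  | one =>
    convert rename_id_apply p
    ext (a | a) <;> rfl
  | mul σ τ _ _ hσ hτ =>
    conv_rhs => rw [← hσ, ← hτ, rename_rename]
    congr 1
    congr 1
    ext (a | a) <;> rfl


/-- The factorial Schur function `s_μ(x|y)` equals the Schur function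
`s_μ(x)` plus terms of lower degree in the `x` variables; in particular `s_μ(x|y)` is
symmetric in `x_1,…,x_d`. -/
theorem fSchur_eq_schur_add_lower_and_symmetric
    (d : ℕ) (hd : 1 ≤ d) (μ : Fin d → ℕ) (hμ : IsPartitionVec μ) :
    (∀ m ∈ (fSchur d μ - schurX d μ).support,
        (∑ j : Fin d, m (Sum.inl j)) < wt μ) ∧
    SymmX (fSchur d μ) := by
  refine ⟨fun m hm => mem_xDegIn.1 (fSchur_sub_schurX_mem_xDegIn d μ) m hm, ?_⟩
  obtain ⟨n, rfl⟩ := Nat.exists_eq_add_of_le' hd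
  exact symmX_of_swap fun i => swapX_fSchur (Nat.succ_lt_succ i.2) μ

end EqLR
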